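/- Let ι be a finite index type, let α be a real number with 0 < α < 1, let a, b : ι → ℝ, and let y : ℤ → (ι → ℝ) be given by y(k) = a + k·b (componentwise). Define s1(τ) = ∑_{i=0}^∞ α(1-α)^i y(τ-i) and s2(τ) = ∑_{j=0}^∞ α(1-α)^j s1(τ-j) (componentwise sums), L(τ) = 2·s1(τ) - s2(τ), and T(τ) = (α/(1-α))·(s1(τ) - s2(τ)). Then for every τ ∈ ℤ and every m ∈ ℕ, L(τ) + m·T(τ) = y(τ+m) = a + (τ+m)·b. -/

import Mathlib

/-- Exponential smoothing of a linear sequence delays it by `(1 - α) / α` time steps. -/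
theorem hasSum_exponential_smoothing_linear {α : ℝ} (hα0 : 0 < α) (hα1 : α < 1) (c d : ℝ) :
    HasSum (fun i : ℕ => α * (1 - α) ^ i * (c - (i : ℝ) * d)) (c - (1 - α) / α * d) := by
  have hr : ‖1 - α‖ < 1 := by
    rw [Real.norm_eq_abs, abs_lt]
    constructor <;> linarith
  have hgeom := (hasSum_geometric_of_norm_lt_one hr).mul_left (α * c)
  have hmoment := (hasSum_coe_mul_geometric_of_norm_lt_one hr).mul_left (α * d)
  convert! hgeom.sub hmoment using 1
  · funext i
    ring
  · rw [sub_sub_cancel]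
    field_simp

theorem mdes_forecast_exact_for_linear {ι : Type*} [Fintype ι]
    (α : ℝ) (hα0 : 0 < α) (hα1 : α < 1)
    (a b : ι → ℝ) (y : ℤ → ι → ℝ)
    (hy : ∀ (k : ℤ) (x : ι), y k x = a x + (k : ℝ) * b x)
    (s1 s2 L T : ℤ → ι → ℝ)
    (hs1 : ∀ (τ : ℤ) (x : ι), s1 τ x = ∑' i : ℕ, α * (1 - α) ^ i * y (τ - (i : ℤ)) x)
    (hs2 : ∀ (τ : ℤ) (x : ι), s2 τ x = ∑' j : ℕ, α * (1 - α) ^ j * s1 (τ - (j : ℤ)) x)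
    (hL : ∀ (τ : ℤ) (x : ι), L τ x = 2 * s1 τ x - s2 τ x)
    (hT : ∀ (τ : ℤ) (x : ι), T τ x = (α / (1 - α)) * (s1 τ x - s2 τ x)) :
    ∀ (τ : ℤ) (m : ℕ) (x : ι),
      L τ x + (m : ℝ) * T τ x = y (τ + (m : ℤ)) x ∧
      y (τ + (m : ℤ)) x = a x + ((τ : ℝ) + (m : ℝ)) * b x := by
  have h1 (τ : ℤ) (x : ι) : s1 τ x = a x + τ * b x - (1 - α) / α * b x := by
    rw [hs1, ← (hasSum_exponential_smoothing_linear hα0 hα1 (a x + τ * b x) (b x)).tsum_eq]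
    refine tsum_congr fun i => ?_
    rw [hy]
    push_cast
    ring
  have h2 (τ : ℤ) (x : ι) :
      s2 τ x = a x + τ * b x - (1 - α) / α * b x - (1 - α) / α * b x := by
    rw [hs2, ← (hasSum_exponential_smoothing_linear hα0 hα1
      (a x + τ * b x - (1 - α) / α * b x) (b x)).tsum_eq]
    refine tsum_congr fun j => ?_
    rw [h1]
    push_cast
    ring
  intro τ m x
  have hy' : y (τ + (m : ℤ)) x = a x + ((τ : ℝ) + (m : ℝ)) * b x := by
    rw [hy]
    push_cast
    rfl
  refine ⟨?_, hy'⟩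
  have hα : 1 - α ≠ 0 := by linarith
  rw [hy', hL, hT, h1, h2]
  field_simp
  ring
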